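/- arXiv:math/0608067 — 2 statements merged into one kernel-verified Lean document; each statement's English description precedes it below -/
import Mathlib

section
/- If λ/√(1+λ²) is irrational, then for a complete geodesic γ of curvature λ contained in a Clifford torus T_ρ (with λ = (2ρ²−1)/(2ρ√(1−ρ²))), the image of γ is dense in T_ρ. -/
open Real
open scoped RealInnerProductSpace

def qi : Quaternion ℝ := ⟨0, 1, 0, 0⟩

/-- The Clifford torus `T_ρ = {|z1|² = ρ², |z2|² = 1−ρ²} ⊂ S³`. -/
def cliffordTorus (ρ : ℝ) : Set (Quaternion ℝ) :=
  {q | q.re ^ 2 + q.imI ^ 2 = ρ ^ 2 ∧ q.imJ ^ 2 + q.imK ^ 2 = 1 - ρ ^ 2}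

/-- First complex coordinate. -/
noncomputable def cpA : Quaternion ℝ →ₗ[ℝ] ℂ where
  toFun q := ⟨q.re, q.imI⟩
  map_add' x y := by apply Complex.ext <;> simp
  map_smul' c x := by apply Complex.ext <;> simp

/-- Second complex coordinate. -/
noncomputable def cpB : Quaternion ℝ →ₗ[ℝ] ℂ where
  toFun q := ⟨q.imJ, q.imK⟩
  map_add' x y := by apply Complex.ext <;> simp
  map_smul' c x := by apply Complex.ext <;> simp

/-- Assemble a quaternion. -/
noncomputable def cpQ : ℂ × ℂ →ₗ[ℝ] Quaternion ℝ where
  toFun p := ⟨p.1.re, p.1.im, p.2.re, p.2.im⟩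
  map_add' x y := by apply Quaternion.ext <;> simp <;> rfl
  map_smul' c x := by apply Quaternion.ext <;> simp <;> rfl

lemma cpQ_eq (q : Quaternion ℝ) : cpQ (cpA q, cpB q) = q := by
  apply Quaternion.ext <;> rfl

lemma cpA_qi (q : Quaternion ℝ) : cpA (qi * q) = Complex.I * cpA q := by
  apply Complex.ext <;> simp [cpA, Quaternion.re_mul, Quaternion.imI_mul] <;> simp [qi]

lemma cpB_qi (q : Quaternion ℝ) : cpB (qi * q) = Complex.I * cpB q := by
  apply Complex.ext <;> simp [cpB, Quaternion.re_mul, Quaternion.imI_mul] <;> simp [qi]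

lemma cp_inner (p q : Quaternion ℝ) :
    ⟪p, q⟫ = (cpA p * (starRingEnd ℂ) (cpA q)).re + (cpB p * (starRingEnd ℂ) (cpB q)).re := by
  rw [Quaternion.inner_def]
  simp [cpA, cpB]
  ring

/-- First-order decoupling. -/
lemma first_integral (m n : ℝ) (hmn : m * n = -1) (f f' f'' : ℝ → ℂ)
    (h1 : ∀ s, HasDerivAt f (f' s) s) (h2 : ∀ s, HasDerivAt f' (f'' s) s)
    (h : ∀ s, f'' s + f s - ((m + n : ℝ) : ℂ) * (Complex.I * f' s) = 0) (s : ℝ) :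
    f' s - Complex.I * n * f s = (f' 0 - Complex.I * n * f 0) * Complex.exp (Complex.I * m * s) := by
  have hE : ∀ s : ℝ, HasDerivAt (fun s : ℝ => Complex.exp (-(Complex.I * m * s)))
      (Complex.exp (-(Complex.I * m * s)) * (-(Complex.I * m * 1))) s := by
    intro s
    exact (((Complex.ofRealCLM.hasDerivAt (x := s)).const_mul (Complex.I * m)).neg).cexp
  have hg : ∀ s : ℝ, HasDerivAt (fun s : ℝ => (f' s - Complex.I * n * f s) *
      Complex.exp (-(Complex.I * m * s))) 0 s := by
    intro s
    have := ((h2 s).sub ((h1 s).const_mul (Complex.I * n))).mul (hE s)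
    refine HasDerivAt.congr_deriv this (Eq.symm ?_)
    have hh := h s
    have hmn' : (m : ℂ) * n = -1 := by exact_mod_cast hmn
    push_cast at hh
    simp only [Pi.sub_apply]
    linear_combination (-Complex.exp (-(Complex.I * m * s))) * hh
      - Complex.exp (-(Complex.I * m * s)) * f s * (Complex.I ^ 2 * hmn' - Complex.I_sq)
  have hc := is_const_of_deriv_eq_zero (fun s => (hg s).differentiableAt) (fun s => (hg s).deriv) s 0
  simp only [Complex.ofReal_zero, mul_zero, neg_zero, Complex.exp_zero, mul_one] at hc
  rw [← hc, mul_assoc _ (Complex.exp _) (Complex.exp _), ← Complex.exp_add]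
  simp

lemma single_freq (m n : ℝ) (hmn : m * n = -1) (hne : n < m) (R : ℝ) (f f' f'' : ℝ → ℂ)
    (h1 : ∀ s, HasDerivAt f (f' s) s) (h2 : ∀ s, HasDerivAt f' (f'' s) s)
    (h : ∀ s, f'' s + f s - ((m + n : ℝ) : ℂ) * (Complex.I * f' s) = 0)
    (hR : ∀ s, Complex.normSq (f s) = R) :
    ∃ k : ℝ, (k = m ∨ k = n) ∧ f' 0 = Complex.I * k * f 0 ∧
      ∀ s : ℝ, f s = f 0 * Complex.exp (Complex.I * k * s) := by
  have ha := first_integral m n hmn f f' f'' h1 h2 h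
  have hb := first_integral n m (by linarith) f f' f'' h1 h2 (by simpa [add_comm n m] using h)
  have hd : ((m : ℂ) - n) ≠ 0 := by
    have : m - n ≠ 0 := by linarith
    exact_mod_cast this
  set a := f' 0 - Complex.I * n * f 0 with ha'
  set b := f' 0 - Complex.I * m * f 0 with hb'
  have key : ∀ s : ℝ, Complex.I * (m - n) * f s =
      a * Complex.exp (Complex.I * m * s) - b * Complex.exp (Complex.I * n * s) := by
    intro s; rw [← ha s, ← hb s]; ring
  have key2 : ∀ s : ℝ, Complex.normSq (a * Complex.exp (Complex.I * ((m - n) * s : ℝ)) - b)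
      = (m - n) ^ 2 * R := by
    intro s
    have e : a * Complex.exp (Complex.I * m * s) - b * Complex.exp (Complex.I * n * s) =
        (a * Complex.exp (Complex.I * ((m - n) * s : ℝ)) - b) * Complex.exp ((n * s : ℝ) * Complex.I) := by
      rw [sub_mul (a * _) b, mul_assoc a, ← Complex.exp_add]
      congr 3
      · push_cast; ring
      · push_cast; ring_nf
    have k := congrArg Complex.normSq (key s)
    rw [e, map_mul, map_mul, map_mul, hR s, Complex.normSq_eq_norm_sq (Complex.exp _),
      Complex.norm_exp_ofReal_mul_I] at k
    rw [← Complex.ofReal_sub, Complex.normSq_ofReal] at k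
    rw [one_pow, mul_one, Complex.normSq_I, one_mul] at k
    rw [← k]; ring
  have hd' : m - n ≠ 0 := by linarith
  have k0 := key2 0
  have k1 := key2 (π / (m - n))
  have k2 := key2 ((π / 2) / (m - n))
  rw [mul_div_cancel₀ _ hd', mul_comm Complex.I] at k1 k2
  rw [Complex.exp_pi_mul_I] at k1
  have e2 : Complex.exp (((π / 2 : ℝ) : ℂ) * Complex.I) = Complex.I := by
    push_cast; exact Complex.exp_pi_div_two_mul_I
  rw [e2] at k2
  simp [Complex.normSq_apply] at k0 k1 k2
  have hx : a.re * b.re + a.im * b.im = 0 := by linarith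
  have hy : a.im * b.re - a.re * b.im = 0 := by linarith
  have hab : a = 0 ∨ b = 0 := by
    have : Complex.normSq a * Complex.normSq b = 0 := by
      simp only [Complex.normSq_apply]
      linear_combination (a.re * b.re + a.im * b.im) * hx + (a.im * b.re - a.re * b.im) * hy
    rcases mul_eq_zero.1 this with h | h
    · left; exact Complex.normSq_eq_zero.1 h
    · right; exact Complex.normSq_eq_zero.1 h
  have hId : Complex.I * ((m : ℂ) - n) ≠ 0 := mul_ne_zero Complex.I_ne_zero hd
  rcases hab with h0 | h0
  · refine ⟨n, Or.inr rfl, by rwa [ha', sub_eq_zero] at h0, fun s => ?_⟩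
    apply mul_left_cancel₀ hId
    have k0 := key 0
    have ks := key s
    rw [h0] at k0 ks
    simp at k0
    rw [ks, ← mul_assoc, k0]; ring
  · refine ⟨m, Or.inl rfl, by rwa [hb', sub_eq_zero] at h0, fun s => ?_⟩
    apply mul_left_cancel₀ hId
    have k0 := key 0
    have ks := key s
    rw [h0] at k0 ks
    simp at k0
    rw [ks, ← mul_assoc, k0]; ring

lemma exists_rot (z w : ℂ) (hz : z ≠ 0) (h : Complex.normSq z = Complex.normSq w) :
    ∃ α : ℝ, w = z * Complex.exp (Complex.I * α) := by
  have hn : ‖w / z‖ = 1 := by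
    have : ‖z‖ = ‖w‖ := by
      rw [Complex.normSq_eq_norm_sq, Complex.normSq_eq_norm_sq] at h
      exact (pow_left_inj₀ (norm_nonneg _) (norm_nonneg _) two_ne_zero).1 h
    rw [norm_div, ← this, div_self (norm_ne_zero_iff.2 hz)]
  refine ⟨(w / z).arg, ?_⟩
  have := Complex.norm_mul_exp_arg_mul_I (w / z)
  rw [hn] at this
  rw [mul_comm Complex.I, ← one_mul (Complex.exp _)]
  rw [Complex.ofReal_one] at this
  rw [this]; field_simp

lemma irr_ratio (lam w : ℝ) (hw : 0 < w) (hirr : Irrational (lam / w)) (k l : ℝ)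
    (hk : k = -lam + w ∨ k = -lam - w) (hl : l = -lam + w ∨ l = -lam - w) (hkl : k ≠ l)
    (hk0 : k ≠ 0) : Irrational (l / k) := by
  rintro ⟨q, hq⟩
  have hq' : l = q * k := by rw [hq]; field_simp
  have hq1 : (q : ℝ) - 1 ≠ 0 := by
    intro h
    apply hkl
    rw [hq', sub_eq_zero.1 h, one_mul]
  apply hirr
  rcases hk with rfl | rfl <;> rcases hl with rfl | rfl
  · exact absurd rfl hkl
  · refine ⟨(q + 1) / (q - 1), ?_⟩
    push_cast
    rw [div_eq_div_iff hq1 hw.ne']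
    linarith
  · refine ⟨-(q + 1) / (q - 1), ?_⟩
    push_cast
    rw [div_eq_div_iff hq1 hw.ne']
    linarith
  · exact absurd rfl hkl

/-- If `λ/√(1+λ²)` is irrational, a complete geodesic of curvature
`λ = (2ρ²−1)/(2ρ√(1−ρ²))` contained in the Clifford torus `T_ρ` has dense image
in `T_ρ`. -/
theorem geodesic_dense_in_torus (ρ lam : ℝ) (hρ : ρ ∈ Set.Ioo (0:ℝ) 1)
    (hlam : lam = (2 * ρ ^ 2 - 1) / (2 * ρ * Real.sqrt (1 - ρ ^ 2)))
    (hirr : Irrational (lam / Real.sqrt (1 + lam ^ 2)))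
    (γ γ' γ'' : ℝ → Quaternion ℝ)
    (hp : ‖γ 0‖ = 1) (hv : ‖γ' 0‖ = 1)
    (htan : ⟪γ' 0, γ 0⟫ = 0) (hhor : ⟪γ' 0, qi * γ 0⟫ = 0)
    (hd1 : ∀ s, HasDerivAt γ (γ' s) s) (hd2 : ∀ s, HasDerivAt γ' (γ'' s) s)
    (heq : ∀ s, γ'' s + γ s + (2 * lam) • (qi * γ' s) = 0)
    (hsub : Set.range γ ⊆ cliffordTorus ρ) :
    closure (Set.range γ) = cliffordTorus ρ := by
  obtain ⟨hρ0, hρ1⟩ := hρ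
  have hρ2 : 0 < ρ ^ 2 := by positivity
  have hρ3 : 0 < 1 - ρ ^ 2 := by nlinarith
  set w := Real.sqrt (1 + lam ^ 2) with hw
  have hw2 : w ^ 2 = 1 + lam ^ 2 := Real.sq_sqrt (by positivity)
  have hw0 : 0 < w := Real.sqrt_pos.2 (by positivity)
  have hmn : (-lam + w) * (-lam - w) = -1 := by linarith
  have hsum : ((-lam + w) + (-lam - w)) = -(2 * lam) := by ring
  -- the two coordinates
  have hAd : ∀ (g g' : ℝ → Quaternion ℝ) (L : Quaternion ℝ →ₗ[ℝ] ℂ),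
      (∀ s, HasDerivAt g (g' s) s) → ∀ s, HasDerivAt (fun s => L (g s)) (L (g' s)) s := by
    intro g g' L h s
    exact (LinearMap.toContinuousLinearMap L).hasFDerivAt.comp_hasDerivAt s (h s)
  have hnA : ∀ q ∈ cliffordTorus ρ, Complex.normSq (cpA q) = ρ ^ 2 := by
    intro q hq
    rw [← hq.1, Complex.normSq_apply]; simp [cpA]; ring
  have hnB : ∀ q ∈ cliffordTorus ρ, Complex.normSq (cpB q) = 1 - ρ ^ 2 := by
    intro q hq
    rw [← hq.2, Complex.normSq_apply]; simp [cpB]; ring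
  have hmem : ∀ s, γ s ∈ cliffordTorus ρ := fun s => hsub ⟨s, rfl⟩
  obtain ⟨k, hk, hk', hkA⟩ := single_freq (-lam + w) (-lam - w) hmn (by linarith) (ρ ^ 2)
    (fun s => cpA (γ s)) (fun s => cpA (γ' s)) (fun s => cpA (γ'' s))
    (hAd _ _ _ hd1) (hAd _ _ _ hd2) (fun s => by
      have := congrArg cpA (heq s)
      rw [map_add, map_add, map_smul, cpA_qi, map_zero, Complex.real_smul] at this
      rw [hsum, ← this]; push_cast; ring) (fun s => hnA _ (hmem s))
  obtain ⟨l, hl, hl', hlB⟩ := single_freq (-lam + w) (-lam - w) hmn (by linarith) (1 - ρ ^ 2)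
    (fun s => cpB (γ s)) (fun s => cpB (γ' s)) (fun s => cpB (γ'' s))
    (hAd _ _ _ hd1) (hAd _ _ _ hd2) (fun s => by
      have := congrArg cpB (heq s)
      rw [map_add, map_add, map_smul, cpB_qi, map_zero, Complex.real_smul] at this
      rw [hsum, ← this]; push_cast; ring) (fun s => hnB _ (hmem s))
  have hk0 : k ≠ 0 := by
    rintro rfl
    rcases hk with h | h <;> rw [← h] at hmn <;> simp at hmn
  have hA0 := hnA _ (hmem 0)
  have hB0 := hnB _ (hmem 0)
  have hkl : k ≠ l := by
    rintro rfl
    rw [cp_inner, cpA_qi, cpB_qi, hk', hl'] at hhor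
    apply hk0
    rw [Complex.normSq_apply] at hA0 hB0
    simp at hhor
    nlinarith
  have hirr' := irr_ratio lam w hw0 hirr k l hk hl hkl hk0
  apply Set.Subset.antisymm
  · apply closure_minimal hsub
    have c1 := Quaternion.continuous_re
    have c2 := Quaternion.continuous_imI
    have c3 := Quaternion.continuous_imJ
    have c4 := Quaternion.continuous_imK
    exact (isClosed_eq ((c1.pow 2).add (c2.pow 2)) continuous_const).inter
      (isClosed_eq ((c3.pow 2).add (c4.pow 2)) continuous_const)
  · intro q hq
    have hzA : cpA (γ 0) ≠ 0 := fun h => by rw [h] at hA0; simp at hA0; linarith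
    have hzB : cpB (γ 0) ≠ 0 := fun h => by rw [h] at hB0; simp at hB0; linarith
    obtain ⟨α, hα⟩ := exists_rot _ (cpA q) hzA (hA0.trans (hnA q hq).symm)
    obtain ⟨β, hβ⟩ := exists_rot _ (cpB q) hzB (hB0.trans (hnB q hq).symm)
    have hden : Dense (AddSubgroup.closure {2 * π * (l / k), 2 * π} : Set ℝ) := by
      rw [dense_addSubgroupClosure_pair_iff, mul_div_cancel_left₀ _ (by positivity)]
      exact hirr'
    let F : ℝ → Quaternion ℝ := fun x => cpQ (cpA q,
      cpB (γ 0) * Complex.exp (Complex.I * ((l / k * α + x : ℝ) : ℂ)))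
    have hF : Continuous F := by
      have : Continuous cpQ := LinearMap.continuous_of_finiteDimensional _
      apply this.comp
      fun_prop
    have hq' : F (β - l / k * α) = q := by
      simp only [F, add_sub_cancel]
      rw [← hβ, cpQ_eq]
    rw [← hq']
    apply map_mem_closure hF (hden _)
    intro x hx
    obtain ⟨m, n, rfl⟩ := AddSubgroup.mem_closure_pair.1 hx
    refine ⟨(α + m * (2 * π)) / k, ?_⟩
    rw [← cpQ_eq (γ _)]
    have hkC : (k : ℂ) ≠ 0 := by exact_mod_cast hk0
    have e1 : Complex.exp (Complex.I * k * ((α + m * (2 * π)) / k : ℝ)) =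
        Complex.exp (Complex.I * α) := by
      rw [Complex.exp_eq_exp_iff_exists_int]
      refine ⟨m, ?_⟩
      push_cast; field_simp
    have e2 : Complex.exp (Complex.I * l * ((α + m * (2 * π)) / k : ℝ)) =
        Complex.exp (Complex.I * ((l / k * α + (m • (2 * π * (l / k)) + n • (2 * π)) : ℝ) : ℂ)) := by
      rw [Complex.exp_eq_exp_iff_exists_int]
      refine ⟨-n, ?_⟩
      push_cast [zsmul_eq_mul]; field_simp; ring
    rw [hkA, hlB, e1, e2, ← hα]
end

section
/- Let Γ be a C² horizontal curve in S^3 parameterized by arc-length with h(ε)=⟨Γ''(ε), i·Γ'(ε)⟩, and for fixed λ let γ_ε be the geodesic of curvature λ with γ_ε(0)=Γ(ε), γ_ε'(0)=i·Γ'(ε). Then the vertical component of the variation field X_ε(s)=∂γ_ε(s)/∂ε satisfies ⟨X_ε(s), i·γ_ε(s)⟩ = [sin(√(1+λ²)s)/√(1+λ²)]·[ (sin(√(1+λ²)s)/√(1+λ²))·h(ε) − 2cos(√(1+λ²)s) ]. In particular it has a unique zero s_ε in (0, π/√(1+λ²)), characterized by h(ε) = 2√(1+λ²)·cot(√(1+λ²)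 s_ε). -/
open Real
open scoped RealInnerProductSpace

theorem qi_re : qi.re = 0 := rfl
theorem qi_imI : qi.imI = 1 := rfl
theorem qi_imJ : qi.imJ = 0 := rfl
theorem qi_imK : qi.imK = 0 := rfl

theorem qi_inner (a b : Quaternion ℝ) : ⟪a, b⟫ = a.re * b.re + a.imI * b.imI + a.imJ * b.imJ
    + a.imK * b.imK := by
  rw [Quaternion.inner_def]
  simp
  try ring

theorem qi_sq (a : Quaternion ℝ) : qi * (qi * a) = -a := by
  ext <;> simp [qi_re, qi_imI, qi_imJ, qi_imK]

theorem inner_qi_self (a : Quaternion ℝ) : ⟪a, qi * a⟫ = 0 := by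
  rw [qi_inner]; simp [qi_re, qi_imI, qi_imJ, qi_imK]; try ring

/-- Energy uniqueness for the linear geodesic equation. -/
theorem geo_unique (lam : ℝ) (d d1 d2 : ℝ → Quaternion ℝ)
    (h1 : ∀ s, HasDerivAt d (d1 s) s) (h2 : ∀ s, HasDerivAt d1 (d2 s) s)
    (hg : ∀ s, d2 s + d s + (2 * lam) • (qi * d1 s) = 0)
    (h0 : d 0 = 0) (h10 : d1 0 = 0) (s : ℝ) : d s = 0 := by
  have hE : ∀ t, HasDerivAt (fun s => ⟪d s, d s⟫ + ⟪d1 s, d1 s⟫) 0 t := by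
    intro t
    have := ((h1 t).inner ℝ (h1 t)).add ((h2 t).inner ℝ (h2 t))
    refine this.congr_deriv ?_
    have e : d2 t = - d t - (2 * lam) • (qi * d1 t) := by
      have := hg t
      rw [← sub_eq_zero, ← this]; abel
    have k := inner_qi_self (d1 t)
    rw [e, inner_sub_right, inner_sub_left, inner_neg_left, inner_neg_right, inner_smul_left,
      inner_smul_right, real_inner_comm (d1 t) (qi * d1 t), real_inner_comm (d1 t) (d t)]
    simp [k]
    try rw [real_inner_comm (d1 t) (qi * d1 t)]
    try simp [k]
  have hc := is_const_of_deriv_eq_zero (fun t => (hE t).differentiableAt) (fun t => (hE t).deriv) s 0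
  simp only [h0, h10, inner_zero_left, add_zero] at hc
  have p1 := real_inner_self_nonneg (x := d s)
  have p2 := real_inner_self_nonneg (x := d1 s)
  exact inner_self_eq_zero (𝕜 := ℝ) |>.1 (by linarith)

theorem comb_deriv (A B P Q : Quaternion ℝ) (a b p q : ℝ → ℝ) (a' b' p' q' t : ℝ)
    (ha : HasDerivAt a a' t) (hb : HasDerivAt b b' t) (hp : HasDerivAt p p' t)
    (hq : HasDerivAt q q' t) :
    HasDerivAt (fun s => a s • A + b s • B + p s • P + q s • Q)
      (a' • A + b' • B + p' • P + q' • Q) t :=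
  (((ha.smul_const A).add (hb.smul_const B)).add (hp.smul_const P)).add (hq.smul_const Q)

theorem curve_deriv (G G1 : ℝ → Quaternion ℝ) (a b p q : ℝ) (A P : Quaternion ℝ) (t : ℝ)
    (h1 : HasDerivAt G A t) (h2 : HasDerivAt G1 P t) :
    HasDerivAt (fun e => a • G e + b • (qi * G e) + p • G1 e + q • (qi * G1 e))
      (a • A + b • (qi * A) + p • P + q • (qi * P)) t := by
  have k1 : HasDerivAt (fun e => qi * G e) (qi * A) t := h1.const_mul qi
  have k2 : HasDerivAt (fun e => qi * G1 e) (qi * P) t := h2.const_mul qi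
  have m1 : HasDerivAt (fun e => a • G e) (a • A) t := h1.const_smul a
  have m2 : HasDerivAt (fun e => b • (qi * G e)) (b • (qi * A)) t := k1.const_smul b
  have m3 : HasDerivAt (fun e => p • G1 e) (p • P) t := h2.const_smul p
  have m4 : HasDerivAt (fun e => q • (qi * G1 e)) (q • (qi * P)) t := k2.const_smul q
  exact ((m1.add m2).add m3).add m4

theorem geo_explicit (lam : ℝ) (C D c S : ℝ → ℝ)
    (dC : ∀ t, HasDerivAt C (-lam * D t) t) (dD : ∀ t, HasDerivAt D (lam * C t) t)
    (dc : ∀ t, HasDerivAt c (-(1 + lam ^ 2) * S t) t) (dS : ∀ t, HasDerivAt S (c t) t)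
    (C0 : C 0 = 1) (D0 : D 0 = 0) (c0 : c 0 = 1) (S0 : S 0 = 0)
    (A P : Quaternion ℝ) (d d1 d2 : ℝ → Quaternion ℝ)
    (h1 : ∀ s, HasDerivAt d (d1 s) s) (h2 : ∀ s, HasDerivAt d1 (d2 s) s)
    (hg : ∀ s, d2 s + d s + (2 * lam) • (qi * d1 s) = 0)
    (h0 : d 0 = A) (h10 : d1 0 = qi * P) (s : ℝ) :
    d s = (C s * c s + lam * S s * D s) • A + (lam * S s * C s - D s * c s) • (qi * A)
      + (S s * D s) • P + (S s * C s) • (qi * P) := by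
  have e1 : ∀ t, HasDerivAt (fun s => (C s * c s + lam * S s * D s) • A
      + (lam * S s * C s - D s * c s) • (qi * A) + (S s * D s) • P + (S s * C s) • (qi * P))
      ((-(C t * S t)) • A + (D t * S t) • (qi * A) + (c t * D t + lam * S t * C t) • P
        + (c t * C t - lam * S t * D t) • (qi * P)) t := fun t => by
    apply comb_deriv
    · exact (((dC t).mul (dc t)).add (((dS t).const_mul lam).mul (dD t))).congr_deriv (by ring)
    · exact ((((dS t).const_mul lam).mul (dC t)).sub ((dD t).mul (dc t))).congr_deriv (by ring)
    · exact ((dS t).mul (dD t)).congr_deriv (by ring)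
    · exact ((dS t).mul (dC t)).congr_deriv (by ring)
  have e2 : ∀ t, HasDerivAt (fun t => (-(C t * S t)) • A + (D t * S t) • (qi * A)
      + (c t * D t + lam * S t * C t) • P + (c t * C t - lam * S t * D t) • (qi * P))
      ((lam * D t * S t - C t * c t) • A + (lam * C t * S t + D t * c t) • (qi * A)
      + (-(1 + 2 * lam ^ 2) * S t * D t + 2 * lam * c t * C t) • P
      + (-(1 + 2 * lam ^ 2) * S t * C t - 2 * lam * c t * D t) • (qi * P)) t := fun t => by
    apply comb_deriv
    · exact (((dC t).mul (dS t)).neg).congr_deriv (by ring)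
    · exact ((dD t).mul (dS t)).congr_deriv (by ring)
    · exact (((dc t).mul (dD t)).add (((dS t).const_mul lam).mul (dC t))).congr_deriv (by ring)
    · exact (((dc t).mul (dC t)).sub (((dS t).const_mul lam).mul (dD t))).congr_deriv (by ring)
  have := geo_unique lam _ _ _ (fun t => (h1 t).sub (e1 t)) (fun t => (h2 t).sub (e2 t)) ?_ ?_ ?_ s
  · exact sub_eq_zero.1 this
  · intro t
    have e : d2 t = - d t - (2 * lam) • (qi * d1 t) := by
      rw [← sub_eq_zero, ← hg t]; abel
    simp only [Pi.sub_apply, e, mul_add, mul_sub, mul_smul_comm, qi_sq]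
    module
  · simp [C0, D0, c0, S0, h0]
  · simp [C0, D0, c0, S0, h10]

/-- The algebraic identity behind the formula. -/
theorem vert_alg (lam C D c S : ℝ) (A P R : Quaternion ℝ) (hCD : C ^ 2 + D ^ 2 = 1)
    (hPP : ⟪P, P⟫ = 1) (hPA : ⟪P, A⟫ = 0) (hRA : ⟪R, A⟫ = -1) (hPiA : ⟪P, qi * A⟫ = 0)
    (hRiA : ⟪R, qi * A⟫ = 0) :
    ⟪(C * c + lam * S * D) • P + (lam * S * C - D * c) • (qi * P) + (S * D) • R
        + (S * C) • (qi * R),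
      qi * ((C * c + lam * S * D) • A + (lam * S * C - D * c) • (qi * A) + (S * D) • P
        + (S * C) • (qi * P))⟫ = S * (S * ⟪R, qi * P⟫ - 2 * c) := by
  have key : ⟪(C * c + lam * S * D) • P + (lam * S * C - D * c) • (qi * P) + (S * D) • R
        + (S * C) • (qi * R),
      qi * ((C * c + lam * S * D) • A + (lam * S * C - D * c) • (qi * A) + (S * D) • P
        + (S * C) • (qi * P))⟫ = (C ^ 2 + D ^ 2) * (c ^ 2 * ⟪P, qi * A⟫
        - c * S * (⟪P, P⟫ + lam * ⟪P, A⟫) + S * c * (⟪R, A⟫ + lam * ⟪P, A⟫)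
        + S ^ 2 * (⟪R, qi * P⟫ + lam * ⟪R, qi * A⟫ + lam ^ 2 * ⟪P, qi * A⟫)) := by
    simp only [qi_inner]
    simp [qi_re, qi_imI, qi_imJ, qi_imK]
    ring
  rw [key, hCD, hPP, hPA, hRA, hPiA, hRiA]
  ring

theorem zero_iff (w h s : ℝ) (hw : 0 < w) (hs : s ∈ Set.Ioo 0 (π / w)) :
    sin (w * s) / w * (sin (w * s) / w * h - 2 * cos (w * s)) = 0 ↔
      h = 2 * w * Real.cot (w * s) := by
  have hsin : 0 < sin (w * s) := by
    apply sin_pos_of_pos_of_lt_pi (mul_pos hw hs.1)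
    have := (lt_div_iff₀ hw).1 hs.2
    linarith
  rw [Real.cot_eq_cos_div_sin, mul_eq_zero, or_iff_right (div_pos hsin hw).ne', sub_eq_zero]
  field_simp

theorem cot_unique (w h : ℝ) (hw : 0 < w) :
    ∃! s : ℝ, s ∈ Set.Ioo 0 (π / w) ∧ h = 2 * w * Real.cot (w * s) := by
  have hcot : ∀ x, Real.cot x = tan (π / 2 - x) := fun x => by
    rw [Real.tan_pi_div_two_sub, Real.cot_eq_cos_div_sin, Real.tan_eq_sin_div_cos, inv_div]
  refine ⟨(π / 2 - arctan (h / (2 * w))) / w, ⟨⟨?_, ?_⟩, ?_⟩, ?_⟩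
  · have := arctan_lt_pi_div_two (h / (2 * w))
    exact div_pos (by linarith) hw
  · have := neg_pi_div_two_lt_arctan (h / (2 * w))
    exact div_lt_div_of_pos_right (by linarith) hw
  · rw [hcot, mul_div_cancel₀ _ hw.ne', sub_sub_cancel, tan_arctan]
    field_simp
  · rintro s ⟨hs, e⟩
    have h2 := (lt_div_iff₀ hw).1 hs.2
    have h1 := mul_pos hw hs.1
    rw [e, mul_div_cancel_left₀ _ (by positivity), hcot, arctan_tan (by linarith) (by linarith)]
    field_simp
    ring

/-- Let `Γ` be a C² horizontal arc-length curve in `S³` with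
`h(ε) = ⟨Γ''(ε), i·Γ'(ε)⟩`, and for fixed `λ` let `γ_ε` be the geodesic of
curvature `λ` with `γ_ε(0) = Γ(ε)`, `γ_ε'(0) = i·Γ'(ε)`.  The vertical component
of the variation field `X_ε(s) = ∂γ_ε(s)/∂ε` is
`⟨X_ε(s), i·γ_ε(s)⟩ = (sin(√(1+λ²)s)/√(1+λ²))·((sin(√(1+λ²)s)/√(1+λ²))h(ε) − 2cos(√(1+λ²)s))`;
in particular it has a unique zero `s_ε ∈ (0, π/√(1+λ²))`, characterized by
`h(ε) = 2√(1+λ²)·cot(√(1+λ²)s_ε)`. -/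
theorem vertical_component_of_jacobi (lam : ℝ)
    (Γ Γ' Γ'' : ℝ → Quaternion ℝ) (γ γs γss X : ℝ → ℝ → Quaternion ℝ)
    (hΓsph : ∀ ε, ‖Γ ε‖ = 1) (hΓunit : ∀ ε, ‖Γ' ε‖ = 1)
    (hΓhor : ∀ ε, ⟪Γ' ε, qi * Γ ε⟫ = 0)
    (hΓd1 : ∀ ε, HasDerivAt Γ (Γ' ε) ε) (hΓd2 : ∀ ε, HasDerivAt Γ' (Γ'' ε) ε)
    (hγ0 : ∀ ε, γ ε 0 = Γ ε) (hγs0 : ∀ ε, γs ε 0 = qi * Γ' ε)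
    (hd1 : ∀ ε s, HasDerivAt (γ ε) (γs ε s) s)
    (hd2 : ∀ ε s, HasDerivAt (γs ε) (γss ε s) s)
    (hgeo : ∀ ε s, γss ε s + γ ε s + (2 * lam) • (qi * γs ε s) = 0)
    (hX : ∀ ε s, HasDerivAt (fun e => γ e s) (X ε s) ε) :
    (∀ ε s, ⟪X ε s, qi * γ ε s⟫ =
      Real.sin (Real.sqrt (1 + lam ^ 2) * s) / Real.sqrt (1 + lam ^ 2) *
        (Real.sin (Real.sqrt (1 + lam ^ 2) * s) / Real.sqrt (1 + lam ^ 2)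
            * ⟪Γ'' ε, qi * Γ' ε⟫
          - 2 * Real.cos (Real.sqrt (1 + lam ^ 2) * s))) ∧
    (∀ ε, ∃! s : ℝ, s ∈ Set.Ioo 0 (π / Real.sqrt (1 + lam ^ 2)) ∧
      ⟪X ε s, qi * γ ε s⟫ = 0) ∧
    (∀ ε s, s ∈ Set.Ioo 0 (π / Real.sqrt (1 + lam ^ 2)) →
      (⟪X ε s, qi * γ ε s⟫ = 0 ↔
        ⟪Γ'' ε, qi * Γ' ε⟫ =
          2 * Real.sqrt (1 + lam ^ 2) * Real.cot (Real.sqrt (1 + lam ^ 2) * s))) := by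
  obtain ⟨w, hwdef⟩ : ∃ w, w = Real.sqrt (1 + lam ^ 2) := ⟨_, rfl⟩
  have hw : 0 < w := by rw [hwdef]; positivity
  have hw2 : w ^ 2 = 1 + lam ^ 2 := by rw [hwdef]; exact Real.sq_sqrt (by positivity)
  rw [← hwdef]
  have main : ∀ ε s, ⟪X ε s, qi * γ ε s⟫ =
      sin (w * s) / w * (sin (w * s) / w * ⟪Γ'' ε, qi * Γ' ε⟫ - 2 * cos (w * s)) := by
    intro ε s
    have dC : ∀ t, HasDerivAt (fun s => cos (lam * s)) (-lam * sin (lam * t)) t := fun t =>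
      (((hasDerivAt_id t).const_mul lam).cos).congr_deriv (by simp; ring)
    have dD : ∀ t, HasDerivAt (fun s => sin (lam * s)) (lam * cos (lam * t)) t := fun t =>
      (((hasDerivAt_id t).const_mul lam).sin).congr_deriv (by simp; ring)
    have dc : ∀ t, HasDerivAt (fun s => cos (w * s)) (-(1 + lam ^ 2) * (sin (w * t) / w)) t :=
      fun t => (((hasDerivAt_id t).const_mul w).cos).congr_deriv
        (by rw [← hw2]; simp; field_simp)
    have dS : ∀ t, HasDerivAt (fun s => sin (w * s) / w) (cos (w * t)) t := fun t =>
      ((((hasDerivAt_id t).const_mul w).sin).div_const w).congr_deriv (by simp; field_simp)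
    have ex : ∀ e, _ := fun e => geo_explicit lam _ _ _ _ dC dD dc dS (by simp) (by simp)
      (by simp) (by simp) (Γ e) (Γ' e) (γ e) (γs e) (γss e) (hd1 e) (hd2 e) (hgeo e)
      (hγ0 e) (hγs0 e) s
    have hX' := hX ε s
    rw [funext ex] at hX'
    have hXe := hX'.unique (curve_deriv _ _ _ _ _ _ _ _ _ (hΓd1 ε) (hΓd2 ε))
    have hPP : ∀ ε, ⟪Γ' ε, Γ' ε⟫ = 1 := fun ε => by
      rw [real_inner_self_eq_norm_sq, hΓunit]; norm_num
    have hPA : ∀ ε, ⟪Γ' ε, Γ ε⟫ = 0 := fun ε => by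
      have h1 := (hΓd1 ε).inner ℝ (hΓd1 ε)
      have h2 : (fun t => ⟪Γ t, Γ t⟫) = fun _ => (1 : ℝ) := by
        funext t; rw [real_inner_self_eq_norm_sq, hΓsph]; norm_num
      rw [h2] at h1
      have h3 := h1.unique (hasDerivAt_const ε (1 : ℝ))
      rw [real_inner_comm] at h3
      linarith
    have hRA : ⟪Γ'' ε, Γ ε⟫ = -1 := by
      have h1 := (hΓd2 ε).inner ℝ (hΓd1 ε)
      rw [funext hPA] at h1
      have h3 := h1.unique (hasDerivAt_const ε (0 : ℝ))
      rw [hPP] at h3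
      linarith
    have hRiA : ⟪Γ'' ε, qi * Γ ε⟫ = 0 := by
      have h1 := (hΓd2 ε).inner ℝ ((hΓd1 ε).const_mul qi)
      rw [funext hΓhor] at h1
      have h3 := h1.unique (hasDerivAt_const ε (0 : ℝ))
      rw [inner_qi_self] at h3
      linarith
    rw [hXe, ex ε]
    exact vert_alg lam _ _ _ _ _ _ _ (cos_sq_add_sin_sq _) (hPP ε) (hPA ε) hRA (hΓhor ε) hRiA
  have third : ∀ ε s, s ∈ Set.Ioo 0 (π / w) → (⟪X ε s, qi * γ ε s⟫ = 0 ↔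
      ⟪Γ'' ε, qi * Γ' ε⟫ = 2 * w * Real.cot (w * s)) := fun ε s hs => by
    rw [main]; exact zero_iff w _ s hw hs
  refine ⟨main, fun ε => ?_, third⟩
  obtain ⟨s, ⟨hs, e⟩, hu⟩ := cot_unique w ⟪Γ'' ε, qi * Γ' ε⟫ hw
  exact ⟨s, ⟨hs, (third ε s hs).2 e⟩, fun t ht => hu t ⟨ht.1, (third ε t ht.1).1 ht.2⟩⟩
end
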